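/- For ν > 1, a ∈ F_{2^{m_1}}^* and b ∈ F_4^*, one has 3·(2^m − 1)·∑_{u ∈ U} (−1)^{f_{a,b}(u)} = −(2^{2^{ν−1}·m} − 1)·(1 − K_{m_1}(a)). -/

import Mathlib

open Finset

attribute [local instance] Classical.propDecidable

noncomputable section

/-- The absolute trace `Tr^k` of `GF(2^k)`, as a function on an ambient field of
characteristic two containing `GF(2^k)`. -/
def absTr {F : Type*} [Field F] (k : ℕ) (x : F) : F :=
  ∑ i ∈ Finset.range k, x ^ 2 ^ i

/-- The relative field trace `Tr^k_j` from `GF(2^k)` to `GF(2^j)`. -/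
def relTr {F : Type*} [Field F] (k j : ℕ) (x : F) : F :=
  ∑ i ∈ Finset.range (k / j), x ^ 2 ^ (j * i)

/-- `(-1)^b` for `b ∈ F_2`, viewed inside an ambient field of characteristic two. -/
def sgn {F : Type*} [Field F] (b : F) : ℤ := if b = 0 then 1 else -1

/-- The subfield `GF(2^k)` of the ambient field, as a finset. -/
def gf (F : Type*) [Field F] [Fintype F] (k : ℕ) : Finset F :=
  Finset.univ.filter fun x => x ^ 2 ^ k = x

/-- The trace of `F_4` down to `F_2`, `tr_2(y) = y + y²`. -/
def tr2 {F : Type*} [Field F] (y : F) : F := y + y ^ 2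

/-- The cubic multiplicative character `χ_k(x) = x^((2^k-1)/3)` of `GF(2^k)`. -/
def chi {F : Type*} [Field F] (k : ℕ) (x : F) : F := x ^ ((2 ^ k - 1) / 3)

/-- The Walsh transform at `ω` of a Boolean function on `GF(2^n)`
(with values in `F_2` inside the ambient field). -/
def walsh {F : Type*} [Field F] [Fintype F] (n : ℕ) (f : F → F) (ω : F) : ℤ :=
  ∑ x : F, sgn (f x + absTr n (ω * x))

/-- The binary Kloosterman sum `K_k(a)` (with the convention `0⁻¹ = 0`). -/
def kloo {F : Type*} [Field F] [Fintype F] (k : ℕ) (a : F) : ℤ :=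
  ∑ x ∈ gf F k, sgn (absTr k (a * x + x⁻¹))

/-- The binary cubic sum `C_k(a,b)`. -/
def cub {F : Type*} [Field F] [Fintype F] (k : ℕ) (a b : F) : ℤ :=
  ∑ x ∈ gf F k, sgn (absTr k (a * x ^ 3 + b * x))

/-- `f_a(x) = Tr^n(a · x^(2^{m₁}-1))`. -/
def fA {F : Type*} [Field F] (n m1 : ℕ) (a x : F) : F :=
  absTr n (a * x ^ (2 ^ m1 - 1))

/-- `g_b(x) = tr_2(b · χ_n(x))`. -/
def gB {F : Type*} [Field F] (n : ℕ) (b x : F) : F := tr2 (b * chi n x)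

/-- The binomial Boolean function `f_{a,b} = f_a + g_b`. -/
def fAB {F : Type*} [Field F] (n m1 : ℕ) (a b x : F) : F :=
  fA n m1 a x + gB n b x

/-- `U`, the image of `U_1 × ⋯ × U_ν` in `GF(2^n)^*` under multiplication, where
`U_i` is the subgroup of `(2^{m_i}+1)`-th roots of unity and `m_i = 2^{ν-i}·m`. -/
def bigU (F : Type*) [Field F] [Fintype F] (ν m : ℕ) : Finset F :=
  Finset.univ.filter fun u => ∃ c : Fin ν → F,
    (∀ i : Fin ν, c i ^ (2 ^ (2 ^ (ν - 1 - (i : ℕ)) * m) + 1) = 1) ∧ u = ∏ i, c i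

/-- The `k`-th roots of unity in a finite field, as a finset. -/
def unityRoots (F : Type*) [Field F] [Fintype F] (k : ℕ) : Finset F :=
  Finset.univ.filter fun x => x ^ k = 1

/-- The product `∏_{j < ν} (2^(2^j·m) + 1)`, the order of the group `U`. -/
def fermatProd (ν m : ℕ) : ℕ := ∏ j ∈ Finset.range ν, (2 ^ (2 ^ j * m) + 1)

section Arithmetic

theorem fermatProd_succ (ν m : ℕ) :
    fermatProd (ν + 1) m = (2 ^ (2 ^ ν * m) + 1) * fermatProd ν m := by
  simp [fermatProd, Finset.prod_range_succ, mul_comm]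

theorem two_pow_sub_one_ne_zero {k : ℕ} (hk : k ≠ 0) : 2 ^ k - 1 ≠ 0 := by
  have := Nat.one_lt_two_pow hk
  omega

theorem sub_one_mul_add_one (k : ℕ) : (2 ^ k - 1) * (2 ^ k + 1) = 2 ^ (k + k) - 1 := by
  rw [pow_add, mul_comm]
  exact (Nat.mul_self_sub_mul_self_eq (2 ^ k) 1).symm

theorem sub_one_mul_fermatProd (ν m : ℕ) :
    (2 ^ m - 1) * fermatProd ν m = 2 ^ (2 ^ ν * m) - 1 := by
  induction ν with
  | zero => simp [fermatProd]
  | succ ν ih =>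
    rw [fermatProd_succ, mul_left_comm, ih, mul_comm, sub_one_mul_add_one]
    congr 2
    ring

theorem coprime_pow_add_one_sub_one {k : ℕ} (hk : k ≠ 0) :
    Nat.Coprime (2 ^ k + 1) (2 ^ k - 1) := by
  obtain ⟨j, rfl⟩ := Nat.exists_eq_add_one_of_ne_zero hk
  have h1 : 1 ≤ 2 ^ j := Nat.one_le_two_pow
  have h : 2 ^ (j + 1) + 1 = (2 ^ (j + 1) - 1) + 2 := by
    rw [pow_succ]; omega
  rw [h, Nat.coprime_self_add_left, Nat.coprime_two_left]
  exact ⟨2 ^ j - 1, by rw [pow_succ]; omega⟩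

theorem coprime_pow_add_one_fermatProd {ν m : ℕ} (hm : m ≠ 0) :
    Nat.Coprime (2 ^ (2 ^ ν * m) + 1) (fermatProd ν m) :=
  (coprime_pow_add_one_sub_one (by positivity)).coprime_dvd_right
    (Dvd.intro_left _ (sub_one_mul_fermatProd ν m))

theorem three_dvd_two_pow_sub_one {k : ℕ} (hk : Even k) : 3 ∣ 2 ^ k - 1 := by
  obtain ⟨j, rfl⟩ := hk.two_dvd
  rw [pow_mul]
  have h := Nat.sub_dvd_pow_sub_pow (2 ^ 2) 1 j
  rwa [one_pow] at h

theorem two_pow_mod_three_of_odd {k : ℕ} (hk : Odd k) : 2 ^ k % 3 = 2 := by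
  obtain ⟨j, rfl⟩ := hk
  rw [pow_succ, pow_mul, Nat.mul_mod, Nat.pow_mod]
  simp

theorem not_three_dvd_sub_one_mul_add_one {m k : ℕ} (hm : Odd m) (hk : Even k) :
    ¬ 3 ∣ (2 ^ m - 1) * (2 ^ k + 1) := by
  rw [Nat.Prime.dvd_mul Nat.prime_three]
  have h1 := two_pow_mod_three_of_odd hm
  have h2 := three_dvd_two_pow_sub_one hk
  have h3 := Nat.one_le_two_pow (n := k)
  generalize 2 ^ m = x at *
  generalize 2 ^ k = y at *
  omega

end Arithmetic

section UnityRoots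

variable {F : Type*} [Field F]

theorem exists_mul_eq_of_pow_mul_eq_one {s t : ℕ} (hst : s.Coprime t) {x : F} (hx : x ≠ 0)
    (h : x ^ (s * t) = 1) : ∃ v w : F, v ^ s = 1 ∧ w ^ t = 1 ∧ x = v * w := by
  have hb := Nat.gcd_eq_gcd_ab s t
  rw [hst.gcd_eq_one] at hb
  have hz : x ^ ((s : ℤ) * t) = 1 := by exact_mod_cast h
  refine ⟨x ^ ((t : ℤ) * s.gcdB t), x ^ ((s : ℤ) * s.gcdA t), ?_, ?_, ?_⟩
  · rw [← zpow_natCast, ← zpow_mul,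
      show (t : ℤ) * s.gcdB t * s = s * t * s.gcdB t by ring, zpow_mul, hz, one_zpow]
  · rw [← zpow_natCast, ← zpow_mul,
      show (s : ℤ) * s.gcdA t * t = s * t * s.gcdA t by ring, zpow_mul, hz, one_zpow]
  · rw [← zpow_add₀ hx, add_comm, ← hb]
    simp

theorem eq_one_of_pow_eq_one_of_coprime {s t : ℕ} (hst : s.Coprime t) {x : F}
    (hs : x ^ s = 1) (ht : x ^ t = 1) : x = 1 :=
  orderOf_eq_one_iff.mp (Nat.eq_one_of_dvd_coprimes hst
    (orderOf_dvd_of_pow_eq_one hs) (orderOf_dvd_of_pow_eq_one ht))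

theorem ne_zero_of_pow_eq_one {k : ℕ} (hk : k ≠ 0) {x : F} (hx : x ^ k = 1) : x ≠ 0 := by
  rintro rfl
  simp [hk] at hx

theorem pow_two_pow_sub_one_eq_one {k : ℕ} {x : F} (h : x ^ 2 ^ k = x) (h0 : x ≠ 0) :
    x ^ (2 ^ k - 1) = 1 := by
  refine mul_right_cancel₀ h0 ?_
  rw [← pow_succ, Nat.sub_add_cancel Nat.one_le_two_pow, h, one_mul]

theorem pow_two_pow_eq_self {k : ℕ} {x : F} (h : x ^ (2 ^ k - 1) = 1) : x ^ 2 ^ k = x := by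
  conv_lhs => rw [← Nat.sub_add_cancel (Nat.one_le_two_pow (n := k)), pow_succ, h, one_mul]

theorem exists_prod_eq_iff_pow_fermatProd_eq_one {m : ℕ} (hm : m ≠ 0) (ν : ℕ) (u : F) :
    (∃ c : Fin ν → F, (∀ i : Fin ν, c i ^ (2 ^ (2 ^ (ν - 1 - (i : ℕ)) * m) + 1) = 1) ∧
      u = ∏ i, c i) ↔ u ^ fermatProd ν m = 1 := by
  induction ν generalizing u with
  | zero => simp [fermatProd]
  | succ ν ih =>
    rw [fermatProd_succ]
    constructor
    · rintro ⟨c, hc, rfl⟩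
      have h0 := hc 0
      have hs := (ih (∏ i : Fin ν, c i.succ)).mp ⟨fun i => c i.succ, fun i => by
        have := hc i.succ
        rwa [Fin.val_succ, show ν + 1 - 1 - ((i : ℕ) + 1) = ν - 1 - (i : ℕ) by omega] at this,
        rfl⟩
      simp only [Fin.val_zero, Nat.add_sub_cancel, Nat.sub_zero] at h0
      rw [Fin.prod_univ_succ, mul_pow, pow_mul, h0, mul_comm _ (fermatProd ν m), pow_mul, hs]
      simp
    · intro hu
      have hne : (2 ^ (2 ^ ν * m) + 1) * fermatProd ν m ≠ 0 :=
        mul_ne_zero (by positivity) (Finset.prod_ne_zero_iff.mpr fun _ _ => by positivity)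
      obtain ⟨v, w, hv, hw, rfl⟩ := exists_mul_eq_of_pow_mul_eq_one
        (coprime_pow_add_one_fermatProd hm) (ne_zero_of_pow_eq_one hne hu) hu
      obtain ⟨c, hc, rfl⟩ := (ih w).mpr hw
      refine ⟨Fin.cons v c, fun i => ?_, by simp [Fin.prod_univ_succ]⟩
      refine Fin.cases ?_ (fun i => ?_) i
      · simpa using hv
      · rw [Fin.cons_succ, Fin.val_succ,
          show ν + 1 - 1 - ((i : ℕ) + 1) = ν - 1 - (i : ℕ) by omega]
        exact hc i

variable [Fintype F]

theorem mem_unityRoots {k : ℕ} {x : F} : x ∈ unityRoots F k ↔ x ^ k = 1 := by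
  simp [unityRoots]

theorem exists_isPrimitiveRoot_of_mul_eq {s t : ℕ} (h : s * t = Fintype.card F - 1) :
    ∃ g : F, IsPrimitiveRoot g (s * t) := by
  obtain ⟨g, hg⟩ := IsCyclic.exists_generator (α := Fˣ)
  refine ⟨g, ?_⟩
  have hc : orderOf g = s * t := by
    rw [orderOf_eq_card_of_forall_mem_zpowers hg, Nat.card_eq_fintype_card, Fintype.card_units, h]
  rw [← hc]
  exact (IsPrimitiveRoot.orderOf g).map_of_injective (f := Units.coeHom F) Units.val_injective

theorem card_unityRoots {s t : ℕ} (h : s * t = Fintype.card F - 1) :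
    #(unityRoots F t) = t := by
  obtain ⟨g, hg⟩ := exists_isPrimitiveRoot_of_mul_eq h
  have hpos : 0 < s * t := by
    rw [h]
    have := Fintype.one_lt_card (α := F)
    omega
  have ht : 0 < t := Nat.pos_of_mul_pos_left hpos
  have hp : IsPrimitiveRoot (g ^ s) t := hg.pow hpos rfl
  refine (congrArg Finset.card ?_).trans hp.card_nthRootsFinset
  ext x
  rw [mem_unityRoots, Polynomial.mem_nthRootsFinset ht]

theorem sum_unityRoots_mul {s t : ℕ} (hst : s.Coprime t) (h0 : s * t ≠ 0) (f : F → ℤ) :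
    ∑ x ∈ unityRoots F (s * t), f x
      = ∑ v ∈ unityRoots F s, ∑ w ∈ unityRoots F t, f (v * w) := by
  rw [← Finset.sum_product']
  symm
  refine Finset.sum_bij (fun p _ => p.1 * p.2) ?_ ?_ ?_ (fun _ _ => rfl)
  · rintro ⟨v, w⟩ hp
    simp only [Finset.mem_product, mem_unityRoots] at hp ⊢
    rw [mul_pow, pow_mul, hp.1, mul_comm s t, pow_mul, hp.2]
    simp
  · rintro ⟨v, w⟩ hp ⟨v', w'⟩ hp' heq
    simp only [Finset.mem_product, mem_unityRoots] at hp hp' heq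
    have hv' : v' ≠ 0 := ne_zero_of_pow_eq_one (left_ne_zero_of_mul h0) hp'.1
    have hw : w ≠ 0 := ne_zero_of_pow_eq_one (right_ne_zero_of_mul h0) hp.2
    have hq : v / v' = w' / w := by
      rw [div_eq_div_iff hv' hw, heq, mul_comm]
    have h1 : v / v' = 1 := by
      refine eq_one_of_pow_eq_one_of_coprime hst ?_ ?_
      · rw [div_pow, hp.1, hp'.1, div_one]
      · rw [hq, div_pow, hp.2, hp'.2, div_one]
    rw [h1, eq_comm, div_eq_one_iff_eq hw] at hq
    rw [div_eq_one_iff_eq hv'] at h1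
    rw [h1, hq]
  · intro x hx
    rw [mem_unityRoots] at hx
    obtain ⟨v, w, hv, hw, rfl⟩ :=
      exists_mul_eq_of_pow_mul_eq_one hst (ne_zero_of_pow_eq_one h0 hx) hx
    exact ⟨(v, w), by simp [mem_unityRoots, hv, hw], rfl⟩

theorem bigU_eq_unityRoots {m : ℕ} (hm : m ≠ 0) (ν : ℕ) :
    bigU F ν m = unityRoots F (fermatProd ν m) := by
  ext u
  rw [mem_unityRoots, ← exists_prod_eq_iff_pow_fermatProd_eq_one hm]
  simp [bigU]

theorem mem_gf {k : ℕ} {x : F} : x ∈ gf F k ↔ x ^ 2 ^ k = x := by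
  simp [gf]

theorem gf_eq_insert (k : ℕ) : gf F k = insert 0 (unityRoots F (2 ^ k - 1)) := by
  ext x
  rw [Finset.mem_insert, mem_unityRoots, mem_gf]
  constructor
  · intro h
    by_cases h0 : x = 0
    · exact Or.inl h0
    · exact Or.inr (pow_two_pow_sub_one_eq_one h h0)
  · rintro (rfl | h)
    · simp
    · exact pow_two_pow_eq_self h

theorem zero_notMem_unityRoots {k : ℕ} (hk : k ≠ 0) : (0 : F) ∉ unityRoots F k := by
  simp [mem_unityRoots, hk]

theorem card_gf {k t : ℕ} (hk : k ≠ 0) (h : t * (2 ^ k - 1) = Fintype.card F - 1) :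
    #(gf F k) = 2 ^ k := by
  rw [gf_eq_insert k, Finset.card_insert_of_notMem
    (zero_notMem_unityRoots (two_pow_sub_one_ne_zero hk)), card_unityRoots h,
    Nat.sub_add_cancel Nat.one_le_two_pow]

end UnityRoots

section Trace

variable {F : Type*} [Field F]

theorem sgn_add [CharP F 2] {x y : F} (hx : x = 0 ∨ x = 1) (hy : y = 0 ∨ y = 1) :
    sgn (x + y) = sgn x * sgn y := by
  rcases hx with rfl | rfl <;> rcases hy with rfl | rfl <;> simp [sgn, CharTwo.add_self_eq_zero]

theorem sgn_zero : sgn (0 : F) = 1 := by simp [sgn]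

theorem sgn_one : sgn (1 : F) = -1 := by simp [sgn]

theorem eq_zero_or_one_of_sq_eq {x : F} (h : x ^ 2 = x) : x = 0 ∨ x = 1 := by
  rcases eq_or_ne x 0 with h0 | h0
  · exact Or.inl h0
  · exact Or.inr (mul_left_cancel₀ h0 (by rw [← sq, h, mul_one]))

theorem absTr_zero {k : ℕ} : absTr k (0 : F) = 0 := by
  simp [absTr]

theorem absTr_sq {k : ℕ} {x : F} (h : x ^ 2 ^ k = x) : absTr k (x ^ 2) = absTr k x := by
  have h1 := Finset.sum_range_succ' (fun i => x ^ 2 ^ i) k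
  have h2 := Finset.sum_range_succ (fun i => x ^ 2 ^ i) k
  rw [h1] at h2
  simp only [pow_zero, pow_one, h] at h2
  have h3 := add_right_cancel h2
  rw [absTr, absTr, ← h3]
  refine Finset.sum_congr rfl fun i _ => ?_
  rw [← pow_mul, pow_succ, mul_comm]

variable [CharP F 2]

theorem absTr_add (k : ℕ) (x y : F) : absTr k (x + y) = absTr k x + absTr k y := by
  simp [absTr, add_pow_char_pow, Finset.sum_add_distrib]

theorem absTr_eq_zero_or_one {k : ℕ} {x : F} (h : x ^ 2 ^ k = x) :
    absTr k x = 0 ∨ absTr k x = 1 := by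
  refine eq_zero_or_one_of_sq_eq ?_
  conv_rhs => rw [← absTr_sq h]
  rw [absTr, absTr, sum_pow_char]
  refine Finset.sum_congr rfl fun i _ => ?_
  rw [← pow_mul, ← pow_mul, mul_comm]

theorem absTr_add_self (k : ℕ) (x : F) : absTr (k + k) x = absTr k (x + x ^ 2 ^ k) := by
  rw [absTr_add, absTr, Finset.sum_range_add]
  congr 1
  refine Finset.sum_congr rfl fun i _ => ?_
  rw [← pow_mul, pow_add]

variable [Fintype F]

theorem exists_absTr_eq_one {k t : ℕ} (hk : k ≠ 0)
    (h : t * (2 ^ k - 1) = Fintype.card F - 1) : ∃ c ∈ gf F k, absTr k c = 1 := by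
  by_contra! hcon
  obtain ⟨j, rfl⟩ := Nat.exists_eq_succ_of_ne_zero hk
  let p : Polynomial F := ∑ i ∈ Finset.range (j + 1), Polynomial.X ^ 2 ^ i
  have hdeg : p.natDegree ≤ 2 ^ j := by
    refine Polynomial.natDegree_sum_le_of_forall_le _ _ fun i hi => ?_
    rw [Polynomial.natDegree_X_pow]
    exact Nat.pow_le_pow_right two_pos (Nat.lt_succ_iff.mp (Finset.mem_range.mp hi))
  have hp0 : p ≠ 0 := by
    intro hp
    have hc : p.coeff 1 = 1 := by
      simp only [p, Polynomial.finsetSum_coeff, Polynomial.coeff_X_pow]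
      rw [Finset.sum_eq_single 0]
      · simp
      · intro i _ hi
        rw [if_neg]
        exact (Nat.one_lt_two_pow hi).ne
      · simp
    simp [hp] at hc
  have hsub : gf F (j + 1) ⊆ p.roots.toFinset := by
    intro c hc
    rw [Multiset.mem_toFinset, Polynomial.mem_roots hp0, Polynomial.IsRoot.def]
    have := (absTr_eq_zero_or_one (mem_gf.mp hc)).resolve_right (hcon c hc)
    simpa [p, Polynomial.eval_finsetSum, absTr] using this
  have h1 := Finset.card_le_card hsub
  have h2 := (Multiset.toFinset_card_le p.roots).trans (p.card_roots'.trans hdeg)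
  rw [card_gf hk h, Nat.succ_eq_add_one, pow_succ] at h1
  have : 0 < 2 ^ j := by positivity
  omega

theorem sum_sgn_absTr_mul {k t : ℕ} (hk : k ≠ 0)
    (h : t * (2 ^ k - 1) = Fintype.card F - 1) {a : F} (ha : a ^ 2 ^ k = a) (ha0 : a ≠ 0) :
    ∑ c ∈ gf F k, sgn (absTr k (a * c)) = 0 := by
  obtain ⟨d, hd, hd1⟩ := exists_absTr_eq_one (F := F) hk h
  have hd' := mem_gf.mp hd
  have hda : (d / a) ^ 2 ^ k = d / a := by rw [div_pow, ha, hd']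
  have key : ∑ c ∈ gf F k, sgn (absTr k (a * c)) = ∑ c ∈ gf F k, -sgn (absTr k (a * c)) := by
    refine Finset.sum_nbij' (fun c => c + d / a) (fun c => c + d / a) ?_ ?_ ?_ ?_ ?_
    · intro c hc
      rw [mem_gf, add_pow_char_pow, mem_gf.mp hc, hda]
    · intro c hc
      rw [mem_gf, add_pow_char_pow, mem_gf.mp hc, hda]
    · intro c _
      rw [add_assoc, CharTwo.add_self_eq_zero, add_zero]
    · intro c _
      rw [add_assoc, CharTwo.add_self_eq_zero, add_zero]
    · intro c hc
      have hac : (a * c) ^ 2 ^ k = a * c := by rw [mul_pow, ha, mem_gf.mp hc]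
      have : a * (c + d / a) = a * c + d := by field_simp
      rw [this, absTr_add, sgn_add (absTr_eq_zero_or_one hac) (absTr_eq_zero_or_one hd'), hd1,
        sgn_one]
      ring
  rw [Finset.sum_neg_distrib] at key
  omega

end Trace

section Kloosterman

variable {F : Type*} [Field F] [CharP F 2]

theorem eq_one_of_add_inv_eq_zero {x : F} (hx : x ≠ 0) (h : x + x⁻¹ = 0) : x = 1 := by
  have h1 : x ^ 2 = 1 := by
    rw [CharTwo.add_eq_zero] at h
    rw [sq]
    nth_rewrite 2 [h]
    exact mul_inv_cancel₀ hx
  have h2 : (x + 1) ^ 2 = 0 := by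
    rw [CharTwo.add_sq, h1, one_pow, CharTwo.add_self_eq_zero]
  exact CharTwo.add_eq_zero.mp (pow_eq_zero_iff two_ne_zero |>.mp h2)

variable [Fintype F]

theorem add_inv_mem_gf {k : ℕ} {v : F}
    (hv : v ∈ unityRoots F (2 ^ k - 1) ∨ v ∈ unityRoots F (2 ^ k + 1)) : v + v⁻¹ ∈ gf F k := by
  rw [mem_gf, add_pow_char_pow, inv_pow]
  rcases hv with hv | hv
  · rw [pow_two_pow_eq_self (mem_unityRoots.mp hv)]
  · rw [mem_unityRoots, pow_succ] at hv
    rw [eq_inv_of_mul_eq_one_left hv, inv_inv, add_comm]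

theorem card_filter_add_inv_le {k : ℕ} (hk : k ≠ 0) (c : F) :
    #({v ∈ unityRoots F (2 ^ k - 1) | v + v⁻¹ = c})
      + #({v ∈ unityRoots F (2 ^ k + 1) | v + v⁻¹ = c}) ≤ 2 := by
  have hm := two_pow_sub_one_ne_zero hk
  have hp : 2 ^ k + 1 ≠ 0 := Nat.succ_ne_zero _
  by_cases hc : c = 0
  · subst hc
    have aux : ∀ j : ℕ, j ≠ 0 → #({v ∈ unityRoots F j | v + v⁻¹ = 0}) ≤ 1 := by
      intro j hj
      rw [Finset.card_le_one_iff_subset_singleton]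
      refine ⟨1, fun v hv => ?_⟩
      rw [Finset.mem_filter, mem_unityRoots] at hv
      rw [Finset.mem_singleton]
      exact eq_one_of_add_inv_eq_zero (ne_zero_of_pow_eq_one hj hv.1) hv.2
    have := aux _ hm
    have := aux _ hp
    omega
  · rw [← Finset.card_union_of_disjoint]
    · let p : Polynomial F := Polynomial.C 1 * Polynomial.X ^ 2
        + Polynomial.C c * Polynomial.X + Polynomial.C 1
      have hp0 : p ≠ 0 := Polynomial.ne_zero_of_natDegree_gt (n := 1)
        (by rw [Polynomial.natDegree_quadratic one_ne_zero]; norm_num)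
      have hdeg : p.natDegree ≤ 2 := Polynomial.natDegree_quadratic_le
      refine (Finset.card_le_card (t := p.roots.toFinset) fun v hv => ?_).trans
        ((Multiset.toFinset_card_le p.roots).trans (p.card_roots'.trans hdeg))
      have hv' : v ≠ 0 ∧ v + v⁻¹ = c := by
        simp only [Finset.mem_union, Finset.mem_filter, mem_unityRoots] at hv
        rcases hv with hv | hv
        · exact ⟨ne_zero_of_pow_eq_one hm hv.1, hv.2⟩
        · exact ⟨ne_zero_of_pow_eq_one hp hv.1, hv.2⟩
      rw [Multiset.mem_toFinset, Polynomial.mem_roots hp0, Polynomial.IsRoot.def]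
      have : v ^ 2 + (v + v⁻¹) * v + 1 = 0 := by
        rw [add_mul, inv_mul_cancel₀ hv'.1, ← sq, ← add_assoc, CharTwo.add_self_eq_zero, zero_add,
          CharTwo.add_self_eq_zero]
      simpa [p, ← hv'.2] using this
    · rw [Finset.disjoint_left]
      intro v hv hv'
      rw [Finset.mem_filter, mem_unityRoots] at hv hv'
      have h1 := eq_one_of_pow_eq_one_of_coprime (coprime_pow_add_one_sub_one hk) hv'.1 hv.1
      apply hc
      rw [← hv.2, h1, inv_one, CharTwo.add_self_eq_zero]

theorem card_filter_add_inv {k : ℕ} (hk : k ≠ 0)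
    (h : Fintype.card F = 2 ^ (k + k)) {c : F} (hc : c ∈ gf F k) :
    #({v ∈ unityRoots F (2 ^ k - 1) | v + v⁻¹ = c})
      + #({v ∈ unityRoots F (2 ^ k + 1) | v + v⁻¹ = c}) = 2 := by
  have h1 : (2 ^ k - 1) * (2 ^ k + 1) = Fintype.card F - 1 := by rw [h, sub_one_mul_add_one]
  have h2 : (2 ^ k + 1) * (2 ^ k - 1) = Fintype.card F - 1 := by rw [← h1, mul_comm]
  refine (Finset.sum_eq_sum_iff_of_le (s := gf F k) (g := fun _ => 2)
    fun c _ => card_filter_add_inv_le hk c).mp ?_ c hc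
  have e1 : #(unityRoots F (2 ^ k - 1))
      = ∑ c ∈ gf F k, #({v ∈ unityRoots F (2 ^ k - 1) | v + v⁻¹ = c}) :=
    Finset.card_eq_sum_card_fiberwise fun v hv => add_inv_mem_gf (Or.inl hv)
  have e2 : #(unityRoots F (2 ^ k + 1))
      = ∑ c ∈ gf F k, #({v ∈ unityRoots F (2 ^ k + 1) | v + v⁻¹ = c}) :=
    Finset.card_eq_sum_card_fiberwise fun v hv => add_inv_mem_gf (Or.inr hv)
  rw [Finset.sum_add_distrib, ← e1, ← e2, card_unityRoots h1, card_unityRoots h2, Finset.sum_const, card_gf hk h2, smul_eq_mul]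
  have := Nat.one_le_two_pow (n := k)
  omega

theorem sum_unityRoots_add_sum_unityRoots {k : ℕ} (hk : k ≠ 0)
    (h : Fintype.card F = 2 ^ (k + k)) (f : F → ℤ) :
    ∑ v ∈ unityRoots F (2 ^ k - 1), f (v + v⁻¹) + ∑ v ∈ unityRoots F (2 ^ k + 1), f (v + v⁻¹)
      = 2 * ∑ c ∈ gf F k, f c := by
  have key : ∀ s : Finset F, (∀ v ∈ s, v + v⁻¹ ∈ gf F k) →
      ∑ v ∈ s, f (v + v⁻¹) = ∑ c ∈ gf F k, (#({v ∈ s | v + v⁻¹ = c}) : ℤ) * f c := by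
    intro s hs
    rw [← Finset.sum_fiberwise_of_maps_to hs]
    refine Finset.sum_congr rfl fun c _ => ?_
    rw [Finset.sum_congr rfl fun v hv => by rw [(Finset.mem_filter.mp hv).2],
      Finset.sum_const, nsmul_eq_mul]
  rw [key _ fun v hv => add_inv_mem_gf (Or.inl hv), key _ fun v hv => add_inv_mem_gf (Or.inr hv),
    ← Finset.sum_add_distrib, Finset.mul_sum]
  refine Finset.sum_congr rfl fun c hc => ?_
  rw [← add_mul]
  congr 1
  exact_mod_cast card_filter_add_inv hk h hc

theorem kloo_eq_one_add {k : ℕ} (hk : k ≠ 0) {a : F} (ha : a ^ 2 ^ k = a) (ha0 : a ≠ 0) :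
    kloo k a = 1 + ∑ v ∈ unityRoots F (2 ^ k - 1), sgn (absTr k (a * (v + v⁻¹))) := by
  have hm := two_pow_sub_one_ne_zero hk
  have ha1 := pow_two_pow_sub_one_eq_one ha ha0
  rw [kloo, gf_eq_insert k, Finset.sum_insert (zero_notMem_unityRoots hm)]
  congr 1
  · simp [absTr_zero, sgn_zero]
  · -- Substitute `v = a * x ^ 2`; the inverse of squaring on `GF(2^k)` is `x ↦ x ^ 2 ^ (k - 1)`.
    obtain ⟨j, rfl⟩ := Nat.exists_eq_succ_of_ne_zero hk
    have hroot : ∀ x : F, x ^ (2 ^ (j + 1) - 1) = 1 → (x ^ 2) ^ 2 ^ j = x := by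
      intro x hx
      rw [← pow_mul, ← pow_succ']
      exact pow_two_pow_eq_self hx
    refine Finset.sum_nbij' (fun x => a * x ^ 2) (fun v => (v / a) ^ 2 ^ j) ?_ ?_ ?_ ?_ ?_
    · intro x hx
      rw [mem_unityRoots] at hx ⊢
      rw [mul_pow, ha1, ← pow_mul, mul_comm 2, pow_mul, hx, one_pow, one_mul]
    · intro v hv
      rw [mem_unityRoots] at hv ⊢
      rw [← pow_mul, mul_comm, pow_mul, div_pow, hv, ha1, div_one, one_pow]
    · intro x hx
      rw [mul_div_cancel_left₀ _ ha0]
      exact hroot x (mem_unityRoots.mp hx)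
    · intro v hv
      rw [mem_unityRoots] at hv
      rw [← pow_mul, mul_comm (2 ^ j), pow_mul, hroot]
      · exact mul_div_cancel₀ v ha0
      · rw [div_pow, hv, ha1, div_one]
    · intro x hx
      have hx1 := mem_unityRoots.mp hx
      have hx0 := ne_zero_of_pow_eq_one hm hx1
      have hxq := pow_two_pow_eq_self hx1
      have h1 : (x⁻¹) ^ 2 ^ (j + 1) = x⁻¹ := by rw [inv_pow, hxq]
      have h2 : (a * x) ^ 2 ^ (j + 1) = a * x := by rw [mul_pow, ha, hxq]
      have h3 : a * (a * x ^ 2 + (a * x ^ 2)⁻¹) = (a * x) ^ 2 + x⁻¹ ^ 2 := by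
        field_simp
      rw [h3, absTr_add, absTr_add, absTr_sq h1, absTr_sq h2]

theorem sum_unityRoots_sgn_absTr {k : ℕ} (hk : k ≠ 0)
    (h : Fintype.card F = 2 ^ (k + k)) {a : F} (ha : a ^ 2 ^ k = a) (ha0 : a ≠ 0) :
    ∑ v ∈ unityRoots F (2 ^ k + 1), sgn (absTr (k + k) (a * v)) = 1 - kloo k a := by
  have h1 : (2 ^ k + 1) * (2 ^ k - 1) = Fintype.card F - 1 := by
    rw [h, mul_comm, sub_one_mul_add_one]
  have hsum := sum_unityRoots_add_sum_unityRoots hk h fun c => sgn (absTr k (a * c))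
  rw [sum_sgn_absTr_mul hk h1 ha ha0] at hsum
  have hU : ∑ v ∈ unityRoots F (2 ^ k + 1), sgn (absTr (k + k) (a * v))
      = ∑ v ∈ unityRoots F (2 ^ k + 1), sgn (absTr k (a * (v + v⁻¹))) := by
    refine Finset.sum_congr rfl fun v hv => ?_
    rw [mem_unityRoots, pow_succ] at hv
    rw [absTr_add_self, mul_pow, ha, eq_inv_of_mul_eq_one_left hv, mul_add]
  rw [hU, kloo_eq_one_add hk ha ha0]
  linarith

theorem sum_unityRoots_sgn_fA {k : ℕ} (hk : k ≠ 0)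
    (h : Fintype.card F = 2 ^ (k + k)) {a : F} (ha : a ^ 2 ^ k = a) (ha0 : a ≠ 0) :
    ∑ v ∈ unityRoots F (2 ^ k + 1), sgn (fA (k + k) k a v) = 1 - kloo k a := by
  rw [← sum_unityRoots_sgn_absTr hk h ha ha0]
  refine Finset.sum_nbij (fun v => v ^ (2 ^ k - 1)) ?_ ?_ ?_ (fun _ _ => rfl)
  · intro v hv
    rw [mem_unityRoots] at hv ⊢
    rw [← pow_mul, mul_comm, pow_mul, hv, one_pow]
  · intro v hv w hw hvw
    rw [Finset.mem_coe, mem_unityRoots] at hv hw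
    have hw0 := ne_zero_of_pow_eq_one (Nat.succ_ne_zero _) hw
    rw [← div_eq_one_iff_eq hw0]
    refine eq_one_of_pow_eq_one_of_coprime (coprime_pow_add_one_sub_one hk) ?_ ?_
    · rw [div_pow, hv, hw, div_one]
    · dsimp only at hvw
      rw [div_pow, hvw, div_self (pow_ne_zero _ hw0)]
  · intro v hv
    rw [Finset.mem_coe, mem_unityRoots] at hv
    have hv0 := ne_zero_of_pow_eq_one (Nat.succ_ne_zero _) hv
    have hb := Nat.gcd_eq_gcd_ab (2 ^ k + 1) (2 ^ k - 1)
    rw [(coprime_pow_add_one_sub_one hk).gcd_eq_one] at hb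
    refine ⟨v ^ (Nat.gcdB (2 ^ k + 1) (2 ^ k - 1)), ?_, ?_⟩
    · rw [Finset.mem_coe, mem_unityRoots, ← zpow_natCast, ← zpow_mul, mul_comm, zpow_mul,
        zpow_natCast, hv, one_zpow]
    · dsimp only
      have hv1 : v ^ ((1 : ℕ) : ℤ) = v := by simp
      rw [← zpow_natCast, ← zpow_mul, mul_comm]
      conv_rhs => rw [← hv1, hb, zpow_add₀ hv0, zpow_mul, zpow_natCast, hv, one_zpow, one_mul]

end Kloosterman

section Cubic

variable {F : Type*} [Field F]

theorem chi_mul (n : ℕ) (x y : F) : chi n (x * y) = chi n x * chi n y := mul_pow _ _ _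

theorem one_add_self_add_sq {ω : F} (hω : ω ^ 3 = 1) (hω1 : ω ≠ 1) : 1 + ω + ω ^ 2 = 0 := by
  refine mul_left_cancel₀ (sub_ne_zero.mpr hω1) ?_
  linear_combination hω

theorem tr2_eq_zero_or_one [CharP F 2] {z : F} (hz : z ^ 3 = 1) : tr2 z = 0 ∨ tr2 z = 1 := by
  by_cases h1 : z = 1
  · left
    rw [tr2, h1, one_pow, CharTwo.add_self_eq_zero]
  · right
    have := one_add_self_add_sq hz h1
    rw [add_assoc, CharTwo.add_eq_zero] at this
    exact this.symm

theorem sgn_tr2_add_add [CharP F 2] {z ω : F} (hz : z ^ 3 = 1) (hω : ω ^ 3 = 1) (hω1 : ω ≠ 1) :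
    sgn (tr2 z) + sgn (tr2 (ω * z)) + sgn (tr2 (ω ^ 2 * z)) = -1 := by
  have h0 := one_add_self_add_sq hω hω1
  have hw : ω + ω ^ 2 = 1 := by
    rw [add_assoc, CharTwo.add_eq_zero] at h0
    exact h0.symm
  have h4 : ω ^ 2 * ω ^ 2 = ω := by linear_combination ω * hω
  have ha : tr2 (1 : F) = 0 := by rw [tr2, one_pow, CharTwo.add_self_eq_zero]
  have hb : tr2 ω = 1 := hw
  have hc : tr2 (ω ^ 2) = 1 := by rw [tr2, sq (ω ^ 2), h4, add_comm, hw]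
  have hz' : z = 1 ∨ z = ω ∨ z = ω ^ 2 := by
    have : (z - 1) * ((z - ω) * (z - ω ^ 2)) = 0 := by
      linear_combination hz + (z - 1) * hω + (z - z ^ 2) * h0
    rcases mul_eq_zero.mp this with h | h
    · exact Or.inl (sub_eq_zero.mp h)
    · rcases mul_eq_zero.mp h with h | h
      · exact Or.inr (Or.inl (sub_eq_zero.mp h))
      · exact Or.inr (Or.inr (sub_eq_zero.mp h))
  have h12 : ω * ω ^ 2 = 1 := by rw [← hω]; ring
  have h21 : ω ^ 2 * ω = 1 := by rw [← hω]; ring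
  rcases hz' with rfl | rfl | rfl
  · simp [ha, hb, hc, sgn_zero, sgn_one]
  · rw [← sq, h21, ha, hb, hc, sgn_zero, sgn_one]; norm_num
  · rw [h12, h4, ha, hb, hc, sgn_zero, sgn_one]; norm_num

variable [Fintype F]

theorem chi_pow_three {n : ℕ} (hn : Even n) (h : Fintype.card F = 2 ^ n) {x : F} (hx : x ≠ 0) :
    chi n x ^ 3 = 1 := by
  rw [chi, ← pow_mul, Nat.div_mul_cancel (three_dvd_two_pow_sub_one hn), ← h]
  exact FiniteField.pow_card_sub_one_eq_one x hx

theorem exists_chi_ne_one {n s t : ℕ} (hn : Even n) (h : Fintype.card F = 2 ^ n)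
    (hst : s * t = 2 ^ n - 1) (hs : ¬ 3 ∣ s) : ∃ w ∈ unityRoots F t, chi n w ≠ 1 := by
  rw [← h] at hst
  obtain ⟨g, hg⟩ := exists_isPrimitiveRoot_of_mul_eq hst
  refine ⟨g ^ s, mem_unityRoots.mpr (by rw [← pow_mul]; exact hg.pow_eq_one), fun h1 => hs ?_⟩
  rw [chi, ← pow_mul, hg.pow_eq_one_iff_dvd, hst, h] at h1
  obtain ⟨d, hd⟩ := three_dvd_two_pow_sub_one hn
  have hd0 : 0 < d := by
    have hc := Fintype.one_lt_card (α := F)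
    rw [h] at hc
    omega
  rw [hd, Nat.mul_div_cancel_left d (by norm_num)] at h1
  exact Nat.dvd_of_mul_dvd_mul_right hd0 h1

theorem three_mul_sum_unityRoots_sgn_gB [CharP F 2] {n s t : ℕ} (hn : Even n)
    (h : Fintype.card F = 2 ^ n) (hst : s * t = 2 ^ n - 1) (hs : ¬ 3 ∣ s) {b : F}
    (hb : b ^ 3 = 1) : 3 * ∑ w ∈ unityRoots F t, sgn (gB n b w) = -(t : ℤ) := by
  obtain ⟨w₀, hw₀, hne⟩ := exists_chi_ne_one (F := F) hn h hst hs
  have ht : t ≠ 0 := by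
    have hc := Fintype.one_lt_card (α := F)
    rw [h] at hc
    rintro rfl
    omega
  have hw₀0 : w₀ ≠ 0 := ne_zero_of_pow_eq_one ht (mem_unityRoots.mp hw₀)
  have shift : ∀ f : F → ℤ,
      ∑ w ∈ unityRoots F t, f (w₀ * w) = ∑ w ∈ unityRoots F t, f w := by
    intro f
    refine Finset.sum_nbij' (fun w => w₀ * w) (fun w => w₀⁻¹ * w) ?_ ?_ ?_ ?_ (fun _ _ => rfl)
    · intro w hw
      rw [mem_unityRoots] at *
      rw [mul_pow, hw₀, hw, one_mul]
    · intro w hw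
      rw [mem_unityRoots] at *
      rw [mul_pow, inv_pow, hw₀, hw, inv_one, one_mul]
    · intro w _
      exact inv_mul_cancel_left₀ hw₀0 w
    · intro w _
      exact mul_inv_cancel_left₀ hw₀0 w
  have hS1 := shift fun w => sgn (gB n b w)
  have hS2 := shift fun w => sgn (gB n b (w₀ * w))
  have hsum : ∑ w ∈ unityRoots F t,
      (sgn (gB n b w) + sgn (gB n b (w₀ * w)) + sgn (gB n b (w₀ * (w₀ * w))))
        = ∑ w ∈ unityRoots F t, (-1 : ℤ) := by
    refine Finset.sum_congr rfl fun w hw => ?_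
    have hw0 : w ≠ 0 := ne_zero_of_pow_eq_one ht (mem_unityRoots.mp hw)
    rw [← sgn_tr2_add_add (z := b * chi n w) (by rw [mul_pow, hb, chi_pow_three hn h hw0, one_mul])
      (chi_pow_three hn h hw₀0) hne]
    simp only [gB, chi_mul]
    ring_nf
  rw [Finset.sum_add_distrib, Finset.sum_add_distrib, hS2, hS1, Finset.sum_const,
    card_unityRoots (hst.trans (by rw [h]))] at hsum
  simp only [nsmul_eq_mul] at hsum
  linarith

end Cubic

theorem sgn_fAB_mul {F : Type*} [Field F] [CharP F 2] [Fintype F] {k t : ℕ} (hk : Even k)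
    (h : Fintype.card F = 2 ^ (k + k)) (ht : t ∣ 2 ^ k - 1) (ht0 : t ≠ 0) {a b v w : F}
    (hb : b ^ 3 = 1) (hv : v ^ (2 ^ k + 1) = 1) (hw : w ^ t = 1) :
    sgn (fAB (k + k) k a b (v * w)) = sgn (fA (k + k) k a v) * sgn (gB (k + k) b w) := by
  have hw' : w ^ (2 ^ k - 1) = 1 := by
    obtain ⟨d, hd⟩ := ht
    rw [hd, pow_mul, hw, one_pow]
  have hchi : chi (k + k) v = 1 := by
    rw [chi, ← sub_one_mul_add_one, mul_comm, Nat.mul_div_assoc _ (three_dvd_two_pow_sub_one hk),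
      pow_mul, hv, one_pow]
  have h1 : fA (k + k) k a (v * w) = fA (k + k) k a v := by
    rw [fA, fA, mul_pow, hw', mul_one]
  have h2 : gB (k + k) b (v * w) = gB (k + k) b w := by
    rw [gB, gB, chi_mul, hchi, one_mul]
  rw [fAB, h1, h2]
  refine sgn_add (absTr_eq_zero_or_one ?_) (tr2_eq_zero_or_one ?_)
  · rw [← h, FiniteField.pow_card]
  · rw [mul_pow, hb, chi_pow_three (Even.add_self k) h (ne_zero_of_pow_eq_one ht0 hw), one_mul]

/-- For `ν > 1`, `a ∈ F_{2^{m₁}}^*` and `b ∈ F_4^*`: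
`3·(2^m − 1)·∑_{u ∈ U} (−1)^{f_{a,b}(u)} = −(2^{2^{ν−1}·m} − 1)·(1 − K_{m₁}(a))`. -/
theorem sum_over_U_even_case
    {F : Type*} [Field F] [Fintype F]
    (n ν m : ℕ) (hν : 1 < ν) (hm : Odd m) (hn : n = 2 ^ ν * m)
    (hF : Fintype.card F = 2 ^ n)
    (a b : F) (ha : a ^ 2 ^ (2 ^ (ν - 1) * m) = a) (ha0 : a ≠ 0)
    (hb : b ^ 3 = 1) (hb0 : b ≠ 0) :
    3 * (2 ^ m - 1) * ∑ u ∈ bigU F ν m, sgn (fAB n (2 ^ (ν - 1) * m) a b u)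
      = -((2 ^ (2 ^ (ν - 1) * m) - 1) * (1 - kloo (2 ^ (ν - 1) * m) a)) := by
  obtain ⟨μ, rfl⟩ : ∃ μ, ν = μ + 1 := ⟨ν - 1, by omega⟩
  have hm0 : m ≠ 0 := hm.pos.ne'
  have hμ : μ ≠ 0 := by omega
  rw [Nat.add_sub_cancel] at ha ⊢
  have hk : n = 2 ^ μ * m + 2 ^ μ * m := by rw [hn, pow_succ]; ring
  have hM := sub_one_mul_fermatProd μ m
  have hcop := coprime_pow_add_one_fermatProd (ν := μ) hm0
  have hk0 : 2 ^ μ * m ≠ 0 := by positivity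
  have hke : Even (2 ^ μ * m) := ((Nat.even_pow' hμ).mpr even_two).mul_right m
  have hM0 : fermatProd μ m ≠ 0 := Finset.prod_ne_zero_iff.mpr fun _ _ => by positivity
  rw [bigU_eq_unityRoots hm0, fermatProd_succ]
  generalize 2 ^ μ * m = k at *
  generalize fermatProd μ m = M at *
  subst hk
  have : CharP F 2 := charP_of_card_eq_prime_pow hF
  have hst : ((2 ^ m - 1) * (2 ^ k + 1)) * M = 2 ^ (k + k) - 1 := by
    rw [mul_right_comm, hM, sub_one_mul_add_one]
  have hW := three_mul_sum_unityRoots_sgn_gB (Even.add_self k) hF hst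
    (not_three_dvd_sub_one_mul_add_one hm hke) hb
  have hsplit : ∑ u ∈ unityRoots F ((2 ^ k + 1) * M), sgn (fAB (k + k) k a b u)
      = (1 - kloo k a) * ∑ w ∈ unityRoots F M, sgn (gB (k + k) b w) := by
    rw [sum_unityRoots_mul hcop (mul_ne_zero (Nat.succ_ne_zero _) hM0),
      ← sum_unityRoots_sgn_fA hk0 hF ha ha0, Finset.sum_mul_sum]
    refine Finset.sum_congr rfl fun v hv => Finset.sum_congr rfl fun w hw => ?_
    exact sgn_fAB_mul hke hF (Dvd.intro_left _ hM) hM0 hb (mem_unityRoots.mp hv)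
      (mem_unityRoots.mp hw)
  have hMZ : ((2 : ℤ) ^ m - 1) * M = 2 ^ k - 1 := by
    have := congrArg (Nat.cast : ℕ → ℤ) hM
    push_cast [Nat.one_le_two_pow] at this
    exact this
  rw [hsplit, ← hMZ]
  linear_combination (2 ^ m - 1) * (1 - kloo k a) * hW
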